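/- With I(α) = ∫₀¹ r^α e^{-1/r} dr, for every real τ the function r ↦ r^τ · Σ_{k ∈ ℤ} r^{2k} / I(2k+1) tends to +∞ as r → 0⁺; in particular no power of r can bound the weighted Bergman kernel of the punctured disc with weight exp(-1/|z|) on the diagonal near the origin. -/

import Mathlib

open MeasureTheory Filter

/-- `I(α) = ∫₀¹ r^α e^{-1/r} dr`. -/
noncomputable def Iw (α : ℝ) : ℝ := ∫ r in Set.Ioo (0:ℝ) 1, r ^ α * Real.exp (-(1/r))

theorem Iw_integrand_nonneg (α : ℝ) {r : ℝ} (hr : r ∈ Set.Ioo (0:ℝ) 1) :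
    0 ≤ r ^ α * Real.exp (-(1/r)) :=
  mul_nonneg (Real.rpow_nonneg hr.1.le _) (Real.exp_pos _).le

theorem Iw_integrand_integrableOn (α : ℝ) :
    IntegrableOn (fun r : ℝ => r ^ α * Real.exp (-(1/r))) (Set.Ioo 0 1) := by
  obtain ⟨n, hn⟩ := exists_nat_ge (-α)
  refine IntegrableOn.of_bound (by simp) (by fun_prop) (n.factorial : ℝ) ?_
  refine (ae_restrict_iff' measurableSet_Ioo).2 (Eventually.of_forall fun r hr => ?_)
  rw [Real.norm_of_nonneg (Iw_integrand_nonneg α hr)]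
  have h1 : r ^ α ≤ (1/r) ^ n := by
    have : r ^ α ≤ r ^ (-(n:ℝ)) :=
      Real.rpow_le_rpow_of_exponent_ge hr.1 hr.2.le (by linarith)
    rwa [Real.rpow_neg hr.1.le, Real.rpow_natCast, ← inv_pow, ← one_div] at this
  have h2 : (1/r) ^ n ≤ n.factorial * Real.exp (1/r) := by
    have := Real.pow_div_factorial_le_exp (1/r) (one_div_pos.2 hr.1).le n
    rwa [div_le_iff₀' (by positivity)] at this
  rw [Real.exp_neg, ← div_eq_mul_inv, div_le_iff₀ (Real.exp_pos _)]
  exact h1.trans h2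

theorem le_Iw {α a b c : ℝ} (ha : 0 < a) (hab : a ≤ b) (hb : b ≤ 1) (hc : 0 ≤ c)
    (h : ∀ x ∈ Set.Ioo a b, c ≤ x ^ α) :
    c * Real.exp (-(1/a)) * (b - a) ≤ Iw α := by
  have hsub : Set.Ioo a b ⊆ Set.Ioo 0 1 := Set.Ioo_subset_Ioo ha.le hb
  have h1 : c * Real.exp (-(1/a)) * volume.real (Set.Ioo a b) ≤
      ∫ r in Set.Ioo a b, r ^ α * Real.exp (-(1/r)) := by
    refine setIntegral_ge_of_const_le_real measurableSet_Ioo (by simp) (fun x hx => ?_)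
      ((Iw_integrand_integrableOn α).mono_set hsub)
    have hx' : 1 / x ≤ 1 / a := one_div_le_one_div_of_le ha hx.1.le
    exact mul_le_mul (h x hx) (Real.exp_le_exp.2 (neg_le_neg hx')) (Real.exp_pos _).le
      (hc.trans (h x hx))
  rw [Real.volume_real_Ioo_of_le hab] at h1
  refine h1.trans (setIntegral_mono_set (Iw_integrand_integrableOn α) ?_ hsub.eventuallyLE)
  exact (ae_restrict_iff' measurableSet_Ioo).2
    (Eventually.of_forall fun r hr => Iw_integrand_nonneg α hr)

theorem exists_mul_zpow_le_Iw_of_nonneg :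
    ∃ C : ℝ, 0 < C ∧ ∀ k : ℤ, 0 ≤ k → C * (1/2 : ℝ) ^ (2*k) ≤ Iw (2*(k:ℝ) + 1) := by
  refine ⟨1/2 * Real.exp (-(1/(1/2))) * (1 - 1/2), by norm_num; positivity, fun k hk => ?_⟩
  have hk' : (0:ℝ) ≤ 2 * k + 1 := by positivity
  have := le_Iw (α := 2*k+1) (a := 1/2) (b := 1) (c := (1/2 : ℝ) ^ (2*(k:ℝ)+1)) (by norm_num)
    (by norm_num) le_rfl (by positivity)
    (fun x hx => Real.rpow_le_rpow (by norm_num) hx.1.le hk')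
  have e : (1/2 : ℝ) ^ (2*(k:ℝ)+1) = (1/2) ^ (2*k) * (1/2) := by
    rw [Real.rpow_add_one (by norm_num), ← Real.rpow_intCast]; push_cast; rfl
  rw [e] at this
  linarith

theorem exists_mul_zpow_le_Iw_of_neg {s : ℝ} (hs : 0 < s) (hs1 : s ≤ 1) :
    ∃ C : ℝ, 0 < C ∧ ∀ k : ℤ, k < 0 → C * s ^ (2*k) ≤ Iw (2*(k:ℝ) + 1) := by
  refine ⟨s * Real.exp (-(1/(s/2))) * (s - s/2),
    mul_pos (by positivity) (by linarith), fun k hk => ?_⟩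
  have hk' : 2 * (k:ℝ) + 1 ≤ 0 := by
    have : (2 * k + 1 : ℤ) ≤ 0 := by omega
    exact_mod_cast this
  have := le_Iw (α := 2*k+1) (a := s/2) (b := s) (c := s ^ (2*(k:ℝ)+1)) (by positivity)
    (by linarith) hs1 (by positivity)
    (fun x hx => Real.rpow_le_rpow_of_nonpos (by linarith [hx.1]) hx.2.le hk')
  have e : s ^ (2*(k:ℝ)+1) = s ^ (2*k) * s := by
    rw [Real.rpow_add_one hs.ne', ← Real.rpow_intCast]; push_cast; rfl
  rw [e] at this
  linarith

theorem Iw_pos (k : ℤ) : 0 < Iw (2*(k:ℝ) + 1) := by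
  rcases le_or_gt 0 k with hk | hk
  · obtain ⟨C, hC, h⟩ := exists_mul_zpow_le_Iw_of_nonneg
    exact lt_of_lt_of_le (by positivity) (h k hk)
  · obtain ⟨C, hC, h⟩ := exists_mul_zpow_le_Iw_of_neg one_pos le_rfl
    exact lt_of_lt_of_le (by positivity) (h k hk)

theorem zpow_div_Iw_le {r s C : ℝ} (hr : 0 < r) (hs : 0 < s) (hC : 0 < C) {k : ℤ}
    (h : C * s ^ (2*k) ≤ Iw (2*(k:ℝ) + 1)) :
    r ^ (2*k) / Iw (2*(k:ℝ) + 1) ≤ C⁻¹ * ((r/s) ^ 2) ^ k := by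
  calc r ^ (2*k) / Iw (2*(k:ℝ) + 1) ≤ r ^ (2*k) / (C * s ^ (2*k)) := by gcongr
    _ = C⁻¹ * ((r/s) ^ 2) ^ k := by
      rw [← zpow_natCast (r/s) 2, ← zpow_mul, div_zpow]
      push_cast
      field_simp

theorem summable_zpow_div_Iw {r : ℝ} (hr : 0 < r) (hr2 : r < 1/2) :
    Summable (fun k : ℤ => r ^ (2*k) / Iw (2*(k:ℝ) + 1)) := by
  have hnn : ∀ k : ℤ, 0 ≤ r ^ (2*k) / Iw (2*(k:ℝ) + 1) := fun k =>
    div_nonneg (by positivity) (Iw_pos k).le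
  refine Summable.of_nat_of_neg_add_one ?_ ?_
  · obtain ⟨C, hC, h⟩ := exists_mul_zpow_le_Iw_of_nonneg
    have hlt : (r/(1/2)) ^ 2 < 1 := by
      rw [sq_lt_one_iff₀ (by positivity), div_lt_one (by norm_num)]
      exact hr2
    refine Summable.of_nonneg_of_le (fun n => hnn n) (fun n => ?_)
      ((summable_geometric_of_lt_one (by positivity) hlt).mul_left C⁻¹)
    have := zpow_div_Iw_le hr (by norm_num) hC (h n (by positivity))
    rwa [zpow_natCast] at this
  · obtain ⟨C, hC, h⟩ := exists_mul_zpow_le_Iw_of_neg (s := r/2) (by positivity) (by linarith)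
    refine Summable.of_nonneg_of_le (fun n => hnn _) (fun n => ?_)
      (((summable_nat_add_iff 1).2 (summable_geometric_of_lt_one (r := (1/4 : ℝ)) (by norm_num)
        (by norm_num))).mul_left C⁻¹)
    have := zpow_div_Iw_le hr (by positivity) hC (h (-((n:ℤ)+1)) (by omega))
    have e : ((r/(r/2)) ^ 2) ^ (-((n:ℤ)+1)) = (1/4 : ℝ) ^ (n+1) := by
      have : r/(r/2) = 2 := by field_simp
      rw [this, zpow_neg, ← inv_zpow, ← Nat.cast_succ, zpow_natCast]
      norm_num
    rwa [e] at this

/-- For every real `τ`, `r^τ · Σ_{k∈ℤ} r^{2k}/I(2k+1) → +∞` as `r → 0⁺`: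
no power of the distance bounds the diagonal weighted Bergman kernel. -/
theorem kernel_diagonal_blowup (τ : ℝ) :
    Tendsto (fun r : ℝ => r ^ τ * ∑' k : ℤ, r ^ (2*k) / Iw (2*(k:ℝ) + 1))
      (nhdsWithin 0 (Set.Ioi 0)) atTop := by
  obtain ⟨N, hN⟩ := exists_int_lt (-τ / 2)
  have hlim : Tendsto (fun r : ℝ => r ^ (τ + 2*(N:ℝ)) / Iw (2*(N:ℝ) + 1))
      (nhdsWithin 0 (Set.Ioi 0)) atTop :=
    (tendsto_rpow_neg_nhdsGT_zero (by linarith)).atTop_div_const (Iw_pos N)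
  refine tendsto_atTop_mono' _ ?_ hlim
  filter_upwards [Ioo_mem_nhdsGT (show (0:ℝ) < 1/2 by norm_num)] with r hr
  have hr0 : 0 < r := hr.1
  have hle := (summable_zpow_div_Iw hr0 hr.2).le_tsum N fun k _ =>
    div_nonneg (by positivity) (Iw_pos k).le
  have e : r ^ (τ + 2*(N:ℝ)) = r ^ τ * r ^ (2*N) := by
    rw [Real.rpow_add hr0, ← Real.rpow_intCast]; push_cast; rfl
  rw [e, mul_div_assoc]
  exact mul_le_mul_of_nonneg_left hle (by positivity)
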